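/- arXiv:2106.14606 — 3 statements merged into one kernel-verified Lean document; each statement's English description precedes it below -/
import Mathlib

section
/- In F2[t_1, ..., t_6] with the Steenrod algebra action, the cohit space QP_5^{⊗6} (degree-5 homogeneous polynomials modulo hit elements) has dimension 111 over F2. -/
open MvPolynomial

/-- The total Steenrod square on `F2[t_1,…,t_h]`: the algebra endomorphism `t_j ↦ t_j + t_j^2`.
Its degree-`(m+k)` homogeneous component on a degree-`m` homogeneous polynomial is `Sq^k`,
which on monomials agrees with the Cartan formula and `Sq^k(t_j^m) = C(m,k) t_j^{m+k}` mod 2. -/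
noncomputable def sqT (h : ℕ) :
    MvPolynomial (Fin h) (ZMod 2) →ₐ[ZMod 2] MvPolynomial (Fin h) (ZMod 2) :=
  aeval (fun j => X j + X j ^ 2)

/-- The hit subspace in degree `n`: the span of all `Sq^k f` with `1 ≤ k ≤ n` and
`f` homogeneous of degree `n − k` (i.e. the degree-`n` component of the total square of `f`). -/
noncomputable def hitSub (h n : ℕ) : Submodule (ZMod 2) (MvPolynomial (Fin h) (ZMod 2)) :=
  Submodule.span (ZMod 2)
    {g | ∃ k f, 1 ≤ k ∧ k ≤ n ∧ MvPolynomial.IsHomogeneous f (n - k) ∧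
      g = MvPolynomial.homogeneousComponent n (sqT h f)}

/-- The cohit space `QP_n^{⊗h}`: degree-`n` homogeneous polynomials modulo hit elements. -/
abbrev QP (h n : ℕ) :=
  ↥(homogeneousSubmodule (Fin h) (ZMod 2) n) ⧸
    ((hitSub h n).comap (homogeneousSubmodule (Fin h) (ZMod 2) n).subtype)

namespace QPaux

abbrev P := MvPolynomial (Fin 6) (ZMod 2)

/-- The product of the variables in a list. -/
noncomputable def mon (l : List (Fin 6)) : P := (l.map X).prod

lemma mon_hom (l : List (Fin 6)) : (mon l).IsHomogeneous l.length := by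
  induction l with
  | nil => simpa [mon] using isHomogeneous_one (Fin 6) (ZMod 2)
  | cons a l ih =>
    have h := (isHomogeneous_X (ZMod 2) a).mul ih
    simpa [mon, add_comm] using h

lemma hc_mon (n : ℕ) (l : List (Fin 6)) :
    homogeneousComponent n (mon l) = if l.length = n then mon l else 0 := by
  rw [homogeneousComponent_of_mem (mon_hom l)]
  simp [eq_comm]

lemma mon_perm {l l' : List (Fin 6)} (h : l.Perm l') : mon l = mon l' :=
  (h.map X).prod_eq

lemma mon_exp (l : List (Fin 6)) :
    mon l = monomial (l.map (fun i => Finsupp.single i 1)).sum 1 := by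
  induction l with
  | nil => simp [mon]
  | cons a l ih =>
    have : mon (a :: l) = X a * mon l := by simp [mon]
    rw [this, ih, X, monomial_mul]
    simp

lemma hom_span {n : ℕ} {p : P} (hp : p.IsHomogeneous n) :
    p ∈ Submodule.span (ZMod 2) {q | ∃ l : List (Fin 6), l.length = n ∧ l.Pairwise (· ≤ ·) ∧ q = mon l} := by
  rw [p.as_sum]
  refine Submodule.sum_mem _ fun d hd => ?_
  have h1 : monomial d (coeff d p) = (coeff d p) • (monomial d (1 : ZMod 2)) := by
    rw [smul_monomial]; simp
  rw [h1]
  refine Submodule.smul_mem _ _ (Submodule.subset_span ?_)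
  refine ⟨(Finsupp.toMultiset d).sort (· ≤ ·), ?_, ?_, ?_⟩
  · have := hp (mem_support_iff.mp hd)
    rw [Multiset.length_sort, Finsupp.card_toMultiset, ← this, Finsupp.weight_apply]
    simp [Finsupp.sum]
  · exact Multiset.pairwise_sort _ _
  · rw [mon_exp]
    congr 1
    have h2 : (((Finsupp.toMultiset d).sort (· ≤ ·)).map (fun i => Finsupp.single i 1)).sum
        = ((Finsupp.toMultiset d).map (fun i => Finsupp.single i 1)).sum := by
      conv_rhs => rw [← Multiset.sort_eq (Finsupp.toMultiset d) (· ≤ ·)]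
      rw [Multiset.map_coe, Multiset.sum_coe]
    rw [h2]
    have h3 := Finsupp.toMultiset_toFinsupp d
    rw [← h3]
    generalize Finsupp.toMultiset d = s
    simp only [Multiset.toFinsupp_toMultiset]
    congr 1
    induction s using Multiset.induction with
    | empty => simp
    | cons a s ih => simp [ih, ← Multiset.singleton_add, Multiset.toFinsupp_singleton]

noncomputable def S1 (a b c d : Fin 6) : P :=
  mon [a,a,b,c,d] + mon [a,b,b,c,d] + mon [a,b,c,c,d] + mon [a,b,c,d,d]

noncomputable def S2 (a b c : Fin 6) : P :=
  mon [a,a,b,b,c] + mon [a,a,b,c,c] + mon [a,b,b,c,c]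

lemma hc0 : homogeneousComponent 5 (sqT 6 (mon [])) = 0 := by
  have : sqT 6 (mon []) = mon [] := by simp [mon]
  rw [this, hc_mon]; simp

lemma hc1 (a : Fin 6) : homogeneousComponent 5 (sqT 6 (mon [a])) = 0 := by
  have : sqT 6 (mon [a]) = mon [a] + mon [a,a] := by simp [mon, sqT]; ring
  rw [this]; simp [hc_mon]

lemma hc2 (a b : Fin 6) : homogeneousComponent 5 (sqT 6 (mon [a,b])) = 0 := by
  have : sqT 6 (mon [a,b]) = mon [a,b] + mon [a,a,b] + mon [a,b,b] + mon [a,a,b,b] := by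
    simp [mon, sqT]; ring
  rw [this]; simp [hc_mon]

lemma hc3 (a b c : Fin 6) : homogeneousComponent 5 (sqT 6 (mon [a,b,c])) = S2 a b c := by
  have : sqT 6 (mon [a,b,c]) = mon [a,b,c] + mon [a,a,b,c] + mon [a,b,b,c] + mon [a,b,c,c]
      + (S2 a b c) + mon [a,a,b,b,c,c] := by
    simp [mon, sqT, S2]; ring
  rw [this]; simp [hc_mon, S2]

lemma hc4 (a b c d : Fin 6) :
    homogeneousComponent 5 (sqT 6 (mon [a,b,c,d])) = S1 a b c d := by
  have : sqT 6 (mon [a,b,c,d]) = mon [a,b,c,d] + (S1 a b c d) + (mon [a,a,b,b,c,d]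
      + mon [a,a,b,c,c,d] + mon [a,a,b,c,d,d] + mon [a,b,b,c,c,d] + mon [a,b,b,c,d,d]
      + mon [a,b,c,c,d,d] + mon [a,a,b,b,c,c,d] + mon [a,a,b,b,c,d,d] + mon [a,a,b,c,c,d,d]
      + mon [a,b,b,c,c,d,d] + mon [a,a,b,b,c,c,d,d]) := by
    simp [mon, sqT, S1]; ring
  rw [this]; simp [hc_mon, S1]

lemma S1_mem (a b c d : Fin 6) : S1 a b c d ∈ hitSub 6 5 :=
  Submodule.subset_span ⟨1, mon [a,b,c,d], by norm_num, by norm_num, mon_hom _, (hc4 a b c d).symm⟩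

lemma S2_mem (a b c : Fin 6) : S2 a b c ∈ hitSub 6 5 :=
  Submodule.subset_span ⟨2, mon [a,b,c], by norm_num, by norm_num, mon_hom _, (hc3 a b c).symm⟩

lemma two_zero : (2 : P) = 0 := by
  have := CharP.cast_eq_zero P 2
  exact_mod_cast this

lemma T_mem (a b c : Fin 6) : mon [a,a,b,b,c] ∈ hitSub 6 5 := by
  have h := Submodule.add_mem _ (S1_mem c c a b) (S2_mem a b c)
  convert h using 1
  simp only [S1, S2, mon, List.map_cons, List.map_nil, List.prod_cons, List.prod_nil]
  linear_combination (-(X c * X c * X c * X a * X b) - X a * X a * X b * X c * X c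
    - X a * X b * X b * X c * X c) * two_zero

/-! ### The basis -/

def F6 : List (Fin 6) := [0,1,2,3,4,5]

def b1 : List (List (Fin 6)) := F6.flatMap fun a => F6.flatMap fun b => F6.flatMap fun c =>
  if b < c ∧ a ≠ b ∧ a ≠ c then [[a,a,a,b,c]] else []

/-- lists `a,b,c,d` for `[a,a,b,c,d]` -/
def b2 : List (List (Fin 6)) := F6.flatMap fun a => F6.flatMap fun b => F6.flatMap fun c =>
  F6.flatMap fun d => if b < c ∧ c < d ∧ b < a ∧ a ≠ c ∧ a ≠ d then [[b,a,a,c,d]] else []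

def b3 : List (List (Fin 6)) :=
  [[0,1,2,3,4],[0,1,2,3,5],[0,1,2,4,5],[0,1,3,4,5],[0,2,3,4,5],[1,2,3,4,5]]

def bl : List (List (Fin 6)) := b1 ++ b2 ++ b3

def code : List (Fin 6) → ℕ
  | [] => 0
  | a :: l => 8 ^ (a : ℕ) + code l

/-- the second code: `[b,a,a,c,d]` gives `[b,b,a,c,d]` -/
def code2 : List (Fin 6) → ℕ
  | b :: _ :: l => code (b :: b :: l)
  | l => code l

def tbl : List (ℕ × ℕ) := b1.map (fun l => (code l, code l)) ++
  b2.map (fun l => (code l, code2 l)) ++ b3.map (fun l => (code l, code l))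

def vv : List (ℕ × ℕ) → ℕ → ℕ
  | [], _ => 0
  | x :: t, n => 2 * vv t n + (if Nat.beq n x.1 || Nat.beq n x.2 then 1 else 0)

def v (n : ℕ) : ℕ := vv tbl n

lemma bl_len : bl.length = 111 := by decide +kernel

lemma chk_b : ∀ i : Fin 111, v (code (bl.getD i [])) = 2 ^ (i : ℕ) := by decide +kernel

lemma bl_len5 : ∀ l ∈ bl, l.length = 5 := by decide +kernel

lemma chk3 : ∀ a b c : Fin 6, a ≤ b → b ≤ c →
    v (code [a,a,b,b,c]) ^^^ v (code [a,a,b,c,c]) ^^^ v (code [a,b,b,c,c]) = 0 := by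
  decide +kernel

lemma chk4 : ∀ a b c d : Fin 6, a ≤ b → b ≤ c → c ≤ d →
    v (code [a,a,b,c,d]) ^^^ v (code [a,b,b,c,d]) ^^^ v (code [a,b,c,c,d])
     ^^^ v (code [a,b,c,d,d]) = 0 := by
  decide +kernel

lemma m1 : ∀ a b c : Fin 6, b < c → a ≠ b → a ≠ c → [a,a,a,b,c] ∈ bl := by decide +kernel
lemma m2 : ∀ b c d a : Fin 6, b < c → c < d → b < a → a ≠ c → a ≠ d → [b,a,a,c,d] ∈ bl := by
  decide +kernel
lemma m3 : ∀ a b : Fin 6, a < b → ∀ c, b < c → ∀ d, c < d → ∀ e, d < e → [a,b,c,d,e] ∈ bl := by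
  decide +kernel

/-! ### Upper bound -/

noncomputable def W : Submodule (ZMod 2) P :=
  hitSub 6 5 ⊔ Submodule.span (ZMod 2) (Set.range fun i : Fin 111 => mon (bl.getD i []))

lemma W_hit {p : P} (h : p ∈ hitSub 6 5) : p ∈ W := Submodule.mem_sup_left h

lemma W_bl {l l' : List (Fin 6)} (h : l ∈ bl) (hp : l'.Perm l) : mon l' ∈ W := by
  rw [mon_perm hp]
  refine Submodule.mem_sup_right (Submodule.subset_span ?_)
  obtain ⟨i, hi, rfl⟩ := List.mem_iff_getElem.mp h
  refine ⟨⟨i, bl_len ▸ hi⟩, ?_⟩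
  simp [hi]

lemma W_T {l : List (Fin 6)} (a b c : Fin 6) (hp : l.Perm [a,a,b,b,c]) : mon l ∈ W := by
  rw [mon_perm hp]
  exact W_hit (T_mem a b c)

lemma W_S (a b c d : Fin 6) (h1 : a < b) (h2 : b < c) (h3 : c < d) : mon [a,a,b,c,d] ∈ W := by
  have e : mon [a,a,b,c,d] = S1 a b c d - mon [a,b,b,c,d] - mon [a,b,c,c,d] - mon [a,b,c,d,d] := by
    simp only [S1]; ring
  rw [e]
  refine W.sub_mem (W.sub_mem (W.sub_mem (W_hit (S1_mem _ _ _ _)) ?_) ?_) ?_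
  · exact W_bl (m2 a c d b (by order) h3 h1 (by order) (by order)) (List.Perm.refl _)
  · refine W_bl (m2 a b d c (by order) (by order) (by order) (by order) (by order)) ?_
    grind
  · refine W_bl (m2 a b c d (by order) (by order) (by order) (by order) (by order)) ?_
    grind

lemma W_sorted (a b c d e : Fin 6) (h1 : a ≤ b) (h2 : b ≤ c) (h3 : c ≤ d) (h4 : d ≤ e) :
    mon [a,b,c,d,e] ∈ W := by
  rcases h1.eq_or_lt with rfl | h1 <;> rcases h2.eq_or_lt with rfl | h2 <;>
  rcases h3.eq_or_lt with rfl | h3 <;> rcases h4.eq_or_lt with rfl | h4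
  · exact W_T a a a (List.Perm.refl _)
  · exact W_T a a e (List.Perm.refl _)
  · exact W_T a d a (by grind)
  · exact W_bl (m1 a d e h4 (by order) (by order)) (List.Perm.refl _)
  · exact W_T a c c (by grind)
  · exact W_T a c e (by grind)
  · exact W_T a d c (by grind)
  · exact W_S _ _ _ _ h2 h3 h4
  · exact W_T b b a (by grind)
  · exact W_bl (m1 b a e (by order) (by order) (by order)) (by grind)
  · exact W_T b d a (by grind)
  · exact W_bl (m2 a d e b (by order) (by order) (by order) (by order) (by order)) (by grind)
  · exact W_bl (m1 c a b (by order) (by order) (by order)) (by grind)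
  · exact W_bl (m2 a b e c (by order) (by order) (by order) (by order) (by order)) (by grind)
  · exact W_bl (m2 a b c d (by order) (by order) (by order) (by order) (by order)) (by grind)
  · exact W_bl (m3 a b h1 c h2 d h3 e h4) (List.Perm.refl _)

lemma hom_W {p : P} (hp : p.IsHomogeneous 5) : p ∈ W := by
  refine Submodule.span_le.mpr ?_ (hom_span hp)
  rintro q ⟨l, hl, hs, rfl⟩
  match l, hl, hs with
  | [a,b,c,d,e], _, hs =>
    simp at hs
    exact W_sorted a b c d e (by tauto) (by tauto) (by tauto) (by tauto)

lemma bl_hom (i : Fin 111) : (mon (bl.getD i [])).IsHomogeneous 5 := by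
  have hi : (i : ℕ) < bl.length := by rw [bl_len]; exact i.2
  have h := bl_len5 _ (List.getElem_mem hi)
  have := mon_hom (bl.getD i [])
  rw [List.getD_eq_getElem _ _ hi] at this ⊢
  rwa [h] at this

noncomputable def gen (i : Fin 111) : QP 6 5 :=
  Submodule.Quotient.mk ⟨mon (bl.getD i []), bl_hom i⟩

lemma gen_span : Submodule.span (ZMod 2) (Set.range gen) = ⊤ := by
  rw [eq_top_iff]
  rintro q -
  obtain ⟨⟨p, hp⟩, rfl⟩ := Submodule.Quotient.mk_surjective _ q
  obtain ⟨h, hh, s, hs, rfl⟩ := Submodule.mem_sup.mp (hom_W hp)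
  obtain ⟨c, rfl⟩ := (Submodule.mem_span_range_iff_exists_fun _).mp hs
  rw [Submodule.mem_span_range_iff_exists_fun]
  refine ⟨c, ?_⟩
  have : ∑ i, c i • gen i = Submodule.Quotient.mk
      (∑ i, c i • (⟨mon (bl.getD i []), bl_hom i⟩ : homogeneousSubmodule (Fin 6) (ZMod 2) 5)) := by
    rw [← Submodule.mkQ_apply, map_sum]
    rfl
  rw [this, eq_comm, Submodule.Quotient.eq]
  simpa using hh

/-! ### Lower bound -/

def bits (n : ℕ) : Fin 111 → ZMod 2 := fun i => if n.testBit i then 1 else 0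

lemma bits_xor (m n : ℕ) : bits (m ^^^ n) = bits m + bits n := by
  funext i
  simp only [bits, Nat.testBit_xor, Pi.add_apply]
  cases m.testBit i <;> cases n.testBit i <;> decide

lemma bits_zero : bits 0 = 0 := by
  funext i; simp [bits]

lemma bits_pow (i : Fin 111) : bits (2 ^ (i : ℕ)) = Pi.single i 1 := by
  funext j
  simp only [bits, Nat.testBit_two_pow, Pi.single_apply, Fin.val_inj, decide_eq_true_eq]
  simp only [eq_comm]

noncomputable def enc (d : Fin 6 →₀ ℕ) : ℕ := ∑ i, d i * 8 ^ (i : ℕ)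

lemma enc_code (l : List (Fin 6)) : enc (l.map (fun i => Finsupp.single i 1)).sum = code l := by
  induction l with
  | nil => simp [enc, code]
  | cons a l ih =>
    rw [code, ← ih]
    simp [enc, add_mul, Finset.sum_add_distrib, Finsupp.single_apply]

noncomputable def L : P →ₗ[ZMod 2] (Fin 111 → ZMod 2) :=
  (basisMonomials (Fin 6) (ZMod 2)).constr (ZMod 2) (fun d => bits (v (enc d)))

lemma L_mon (l : List (Fin 6)) : L (mon l) = bits (v (code l)) := by
  rw [mon_exp, ← enc_code, L]
  have := (basisMonomials (Fin 6) (ZMod 2)).constr_basis (ZMod 2) (fun d => bits (v (enc d)))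
    (l.map (fun i => Finsupp.single i 1)).sum
  simpa using this

lemma L_hc {n : ℕ} (hn : n < 5) {f : P} (hf : f.IsHomogeneous n) :
    L (homogeneousComponent 5 (sqT 6 f)) = 0 := by
  have key : f ∈ LinearMap.ker (L ∘ₗ homogeneousComponent 5 ∘ₗ (sqT 6).toLinearMap) := by
    refine Submodule.span_le.mpr ?_ (hom_span hf)
    rintro q ⟨l, hl, hs, rfl⟩
    simp only [SetLike.mem_coe, LinearMap.mem_ker, LinearMap.comp_apply, AlgHom.toLinearMap_apply]
    match l, hl, hs with
    | [], _, _ => rw [hc0, map_zero]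
    | [a], _, _ => rw [hc1, map_zero]
    | [a,b], _, _ => rw [hc2, map_zero]
    | [a,b,c], _, hs =>
      simp at hs
      rw [hc3, S2, map_add, map_add, L_mon, L_mon, L_mon, ← bits_xor, ← bits_xor,
        chk3 a b c (by tauto) (by tauto), bits_zero]
    | [a,b,c,d], _, hs =>
      simp at hs
      rw [hc4, S1, map_add, map_add, map_add, L_mon, L_mon, L_mon, L_mon, ← bits_xor, ← bits_xor,
        ← bits_xor, chk4 a b c d (by tauto) (by tauto) (by tauto), bits_zero]
    | _ :: _ :: _ :: _ :: _ :: _, hl, _ => simp at hl; omega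
  exact key

lemma hit_ker : hitSub 6 5 ≤ LinearMap.ker L := by
  refine Submodule.span_le.mpr ?_
  rintro g ⟨k, f, h1, h2, hf, rfl⟩
  exact L_hc (by omega) hf

noncomputable def LQ : QP 6 5 →ₗ[ZMod 2] (Fin 111 → ZMod 2) :=
  Submodule.liftQ _ (L ∘ₗ (homogeneousSubmodule (Fin 6) (ZMod 2) 5).subtype)
    (fun _ hx => hit_ker hx)

lemma LQ_gen (i : Fin 111) : LQ (gen i) = Pi.single i 1 := by
  have : LQ (gen i) = L (mon (bl.getD i [])) := rfl
  rw [this, L_mon, chk_b, bits_pow]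

lemma gen_indep : LinearIndependent (ZMod 2) gen := by
  refine LinearIndependent.of_comp LQ ?_
  have : LQ ∘ gen = Pi.basisFun (ZMod 2) (Fin 111) := by
    funext i
    simp [LQ_gen]
  rw [this]
  exact (Pi.basisFun (ZMod 2) (Fin 111)).linearIndependent

end QPaux

/-- The cohit space `QP_5^{⊗6}` has dimension 111 over `F2`. -/
theorem dim_QP_6_5 : Module.finrank (ZMod 2) (QP 6 5) = 111 := by
  have b := Module.Basis.mk QPaux.gen_indep QPaux.gen_span.ge
  simpa using Module.finrank_eq_card_basis b
end

section
/- In F2[t_1, ..., t_7] with the Steenrod algebra action, the cohit space QP_5^{⊗7} (degree-5 homogeneous polynomials modulo hit elements) has dimension 231 over F2. -/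
open MvPolynomial

namespace QPaux

/-- exponent vector with binary digits `A` (units) and `o` (twos). -/
noncomputable def ex (p : Finset (Fin 7) × Option (Fin 7)) : Fin 7 →₀ ℕ :=
  Finsupp.equivFunOnFinite.symm
    (fun j => (if j ∈ p.1 then 1 else 0) + (if p.2 = some j then 2 else 0))

lemma ex_apply (A : Finset (Fin 7)) (o : Option (Fin 7)) (j : Fin 7) :
    ex (A, o) j = (if j ∈ A then 1 else 0) + (if o = some j then 2 else 0) := rfl

/-- the index predicate of the basis -/
def good (p : Finset (Fin 7) × Option (Fin 7)) : Prop :=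
  (p.2 = none ∧ p.1.card = 5) ∨
    (p.1.card = 3 ∧ ∃ i, p.2 = some i ∧ (i ∈ p.1 ∨ ∃ j ∈ p.1, j < i))

instance : DecidablePred good := fun p => by unfold good; infer_instance

/-- the index type of the basis -/
abbrev K := {p : Finset (Fin 7) × Option (Fin 7) // good p}

lemma card_K : Fintype.card K = 231 := by
  decide +kernel

lemma ex_inj : Function.Injective ex := by
  rintro ⟨A, o⟩ ⟨B, q⟩ h
  have h' : ∀ j, ex (A, o) j = ex (B, q) j := fun j => by rw [h]
  simp only [ex_apply] at h'
  have h1 : A = B := by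
    ext j
    have := h' j
    split_ifs at this <;> simp_all
  have h2 : o = q := by
    ext j
    have := h' j
    subst h1
    split_ifs at this <;> simp_all
  rw [h1, h2]

/-- univariate coefficient of the total square -/
noncomputable def uc (d e : ℕ) : ZMod 2 := 
  ((Polynomial.X + Polynomial.X ^ 2 : Polynomial (ZMod 2)) ^ d).coeff e

lemma uc_eq (d e : ℕ) : uc d e = if d ≤ e then ((d.choose (e - d) : ℕ) : ZMod 2) else 0 := by
  have : (Polynomial.X + Polynomial.X ^ 2 : Polynomial (ZMod 2)) ^ d
      = Polynomial.X ^ d * (1 + Polynomial.X) ^ d := by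
    rw [← mul_pow]; ring
  rw [uc, this, Polynomial.coeff_X_pow_mul', Polynomial.coeff_one_add_X_pow]

lemma uc0 (d : ℕ) : uc d 0 = if d = 0 then 1 else 0 := by
  rw [uc_eq]; rcases d with _ | d <;> simp

lemma uc1 (d : ℕ) : uc d 1 = if d = 1 then 1 else 0 := by
  rw [uc_eq]
  by_cases h : d ≤ 1
  · interval_cases d <;> decide
  · rw [if_neg h, if_neg (by omega)]

lemma uc2 (d : ℕ) : uc d 2 = if d = 1 ∨ d = 2 then 1 else 0 := by
  rw [uc_eq]
  by_cases h : d ≤ 2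
  · interval_cases d <;> decide
  · rw [if_neg h, if_neg (by omega)]

lemma uc3 (d : ℕ) : uc d 3 = if d = 3 then 1 else 0 := by
  rw [uc_eq]
  by_cases h : d ≤ 3
  · interval_cases d <;> decide
  · rw [if_neg h, if_neg (by omega)]

lemma coeff_prod (p : Fin 7 → Polynomial (ZMod 2)) (e : Fin 7 →₀ ℕ) :
    coeff e (∏ j, Polynomial.aeval (X j : MvPolynomial (Fin 7) (ZMod 2)) (p j))
      = ∏ j, (p j).coeff (e j) := by
  classical
  have h1 : ∀ j, Polynomial.aeval (X j : MvPolynomial (Fin 7) (ZMod 2)) (p j)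
      = ∑ i ∈ (p j).support ∪ {e j}, monomial (Finsupp.single j i) ((p j).coeff i) := by
    intro j
    rw [Polynomial.aeval_eq_sum_range' (n := (p j).natDegree + 1) (by omega)]
    have : ∀ i, (p j).coeff i • (X j : MvPolynomial (Fin 7) (ZMod 2)) ^ i
        = monomial (Finsupp.single j i) ((p j).coeff i) := by
      intro i
      rw [X_pow_eq_monomial, smul_monomial]; simp
    simp only [this]
    have a1 : ∑ i ∈ (p j).support, monomial (Finsupp.single j i) ((p j).coeff i) = 
      ∑ i ∈ Finset.range ((p j).natDegree + 1), monomial (Finsupp.single j i) ((p j).coeff i) := by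
      apply Finset.sum_subset
      · exact Polynomial.supp_subset_range_natDegree_succ
      · intro i _ hi
        rw [Polynomial.notMem_support_iff.1 hi]; simp
    rw [← a1]
    apply Finset.sum_subset Finset.subset_union_left
    intro i _ hi
    rw [Polynomial.notMem_support_iff.1 hi]; simp
  simp only [h1]
  rw [Finset.prod_univ_sum, coeff_sum]
  have h2 : ∀ x : Fin 7 → ℕ, ∏ j, monomial (Finsupp.single j (x j)) ((p j).coeff (x j))
      = monomial (Finsupp.equivFunOnFinite.symm x) (∏ j, (p j).coeff (x j)) := by
    intro x
    rw [← monomial_sum_prod]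
    have h3 : ∑ i, Finsupp.single i (x i) = Finsupp.equivFunOnFinite.symm x := by
      ext j
      simp [Finsupp.finsetSum_apply, Finsupp.single_apply]
    rw [h3]
  simp only [h2, coeff_monomial]
  rw [Finset.sum_eq_single (fun j => e j)]
  · rw [if_pos]; ext j; rfl
  · intro b _ hb
    rw [if_neg]
    intro h
    apply hb
    rw [← h]; rfl
  · intro h
    exact absurd (Fintype.mem_piFinset.2 (fun j => by simp)) h

lemma coeff_sqT (d e : Fin 7 →₀ ℕ) (r : ZMod 2) :
    coeff e (sqT 7 (monomial d r)) = r * ∏ j, uc (d j) (e j) := by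
  have := coeff_prod (fun j => (Polynomial.X + Polynomial.X ^ 2) ^ (d j)) e
  rw [sqT, aeval_monomial, Finsupp.prod_fintype _ _ (by simp)]
  simp only [uc]
  rw [← this]
  simp [algebraMap_eq] 

lemma prod_spike (d e : Fin 7 →₀ ℕ) (he : ∀ j, e j = 0 ∨ e j = 1 ∨ e j = 3) (h : d ≠ e) :
    ∏ j, uc (d j) (e j) = 0 := by
  obtain ⟨j, hj⟩ : ∃ j, d j ≠ e j := by
    by_contra hc
    push Not at hc
    exact h (Finsupp.ext hc)
  apply Finset.prod_eq_zero (Finset.mem_univ j)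
  rcases he j with h | h | h <;> rw [h] at hj ⊢ <;> simp [uc0, uc1, uc3, hj]

lemma prod_two (d : Fin 7 →₀ ℕ) (A : Finset (Fin 7)) (i : Fin 7) (hi : i ∉ A)
    (h : d ≠ ex (A, some i)) :
    ∏ j, uc (d j) (ex (A, some i) j) = if d = ex (insert i A, none) then 1 else 0 := by
  split_ifs with hd
  · subst hd
    apply Finset.prod_eq_one
    intro j _
    simp only [ex_apply]
    by_cases hj : i = j
    · subst hj; simp [hi, uc2]
    · by_cases hjA : j ∈ A <;> simp [hj, Ne.symm hj, hjA, uc1, uc0]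
  · by_contra hc
    rw [Finset.prod_eq_zero_iff] at hc
    push Not at hc
    have h1 : ∀ j, j ≠ i → d j = ex (A, some i) j := by
      intro j hj
      have := hc j (Finset.mem_univ j)
      simp only [ex_apply] at this ⊢
      by_cases hjA : j ∈ A <;> simpa [Ne.symm hj, hjA, uc1, uc0] using this
    have h2 := hc i (Finset.mem_univ i)
    simp only [ex_apply] at h2
    have h2 : d i = 1 ∨ d i = 2 := by
      by_contra h3
      simp [hi, uc2, h3] at h2
    rcases h2 with h2 | h2
    · apply hd
      ext j
      by_cases hj : j = i
      · subst hj; simp [h2, ex_apply]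
      · rw [h1 j hj]; simp [ex_apply, hj, Ne.symm hj]
    · apply h
      ext j
      by_cases hj : j = i
      · subst hj; simp [h2, ex_apply, hi]
      · rw [h1 j hj]

lemma degree_ex (A : Finset (Fin 7)) (o : Option (Fin 7)) :
    (ex (A, o)).degree = A.card + (if o = none then 0 else 2) := by
  rw [Finsupp.degree_eq_sum]
  simp only [ex_apply, Finset.sum_add_distrib]
  rcases o with _ | i <;> simp

lemma coeff_hit (e : Fin 7 →₀ ℕ) (he : e.degree = 5) (k : ℕ) (f : MvPolynomial (Fin 7) (ZMod 2)) :
    coeff e (homogeneousComponent 5 (sqT 7 f)) = 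
      ∑ d ∈ f.support, coeff d f * ∏ j, uc (d j) (e j) := by
  rw [coeff_homogeneousComponent, if_pos he]
  conv_lhs => rw [f.as_sum, map_sum, coeff_sum]
  simp only [coeff_sqT]

lemma hit_spike (e : Fin 7 →₀ ℕ) (hd : e.degree = 5) (he : ∀ j, e j = 0 ∨ e j = 1 ∨ e j = 3)
    (g : MvPolynomial (Fin 7) (ZMod 2)) (hg : g ∈ hitSub 7 5) : coeff e g = 0 := by
  induction hg using Submodule.span_induction with
  | mem x hx =>
    obtain ⟨k, f, h1, h2, hf, rfl⟩ := hx
    rw [coeff_hit e hd k]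
    apply Finset.sum_eq_zero
    intro d hdf
    rw [prod_spike d e he, mul_zero]
    rintro rfl
    apply mem_support_iff.1 hdf
    apply hf.coeff_eq_zero
    omega
  | zero => simp
  | add x y _ _ hx hy => simp [hx, hy]
  | smul a x _ hx => simp [hx]

lemma hit_two (A B : Finset (Fin 7)) (i j : Fin 7) (hi : i ∉ A) (hj : j ∉ B)
    (hA : A.card = 3) (hB : B.card = 3) (hAB : insert i A = insert j B)
    (g : MvPolynomial (Fin 7) (ZMod 2)) (hg : g ∈ hitSub 7 5) :
    coeff (ex (A, some i)) g = coeff (ex (B, some j)) g := by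
  have dA : (ex (A, some i)).degree = 5 := by simp [degree_ex, hA]
  have dB : (ex (B, some j)).degree = 5 := by simp [degree_ex, hB]
  induction hg using Submodule.span_induction with
  | mem x hx =>
    obtain ⟨k, f, h1, h2, hf, rfl⟩ := hx
    rw [coeff_hit _ dA k, coeff_hit _ dB k]
    apply Finset.sum_congr rfl
    intro d hdf
    have : d.degree = 5 - k := by
      by_contra hne
      exact (mem_support_iff.1 hdf) (hf.coeff_eq_zero hne)
    rw [prod_two d A i hi, prod_two d B j hj, hAB]
    · rintro rfl; omega
    · rintro rfl; omega
  | zero => simp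
  | add x y _ _ hx hy => simp [hx, hy]
  | smul a x _ hx => simp [hx]

lemma mem_hit {g r f : MvPolynomial (Fin 7) (ZMod 2)} (m : ℕ) (hm : m < 5) (hf : f.IsHomogeneous m)
    (hg : g.IsHomogeneous 5) (hr : homogeneousComponent 5 r = 0) (h : sqT 7 f = g + r) :
    g ∈ hitSub 7 5 := by
  apply Submodule.subset_span
  refine ⟨5 - m, f, by omega, by omega, ?_, ?_⟩
  · rwa [show 5 - (5 - m) = m by omega]
  · rw [h, map_add, hr, add_zero]
    rw [homogeneousComponent_of_mem hg, if_pos rfl]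


lemma hc_ne {p : MvPolynomial (Fin 7) (ZMod 2)} (n : ℕ) (h : p.IsHomogeneous n) (hn : n ≠ 5) :
    homogeneousComponent 5 p = 0 := by
  rw [homogeneousComponent_of_mem h, if_neg (Ne.symm hn)]

lemma isH (l : List (Fin 7)) :
    (l.map (fun i => (X i : MvPolynomial (Fin 7) (ZMod 2)))).prod.IsHomogeneous l.length := by
  induction l with
  | nil => simpa using isHomogeneous_one (Fin 7) (ZMod 2)
  | cons a l ih =>
    rw [List.map_cons, List.prod_cons, List.length_cons, add_comm]
    exact (isHomogeneous_X _ a).mul ih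

lemma hit4 (x y z w : Fin 7) :
    (X x * X y * X z * X w * (X x + X y + X z + X w) : MvPolynomial (Fin 7) (ZMod 2))
      ∈ hitSub 7 5 := by
  have hX := fun i => isHomogeneous_X (ZMod 2) (i : Fin 7)
  have h4 : (X x * X y * X z * X w : MvPolynomial (Fin 7) (ZMod 2)).IsHomogeneous 4 :=
    (((hX x).mul (hX y)).mul (hX z)).mul (hX w)
  have e2 := fun a b => (hX a).mul (hX b)
  have e3 := fun a b c => (e2 a b).mul (hX c)
  refine mem_hit (r := X x * X y * X z * X w + (X x * X y * X z * X w) *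
      (X x * X y + X x * X z + X x * X w + X y * X z + X y * X w + X z * X w)
      + (X x * X y * X z * X w) *
        (X x * X y * X z + X x * X y * X w + X x * X z * X w + X y * X z * X w)
      + (X x * X y * X z * X w) * (X x * X y * X z * X w)) 4 (by norm_num) h4
    (h4.mul ((((hX x).add (hX y)).add (hX z)).add (hX w))) ?_ ?_
  · rw [map_add, map_add, map_add, hc_ne 4 h4 (by norm_num),
      hc_ne 6 (h4.mul ((((((e2 _ _).add (e2 _ _)).add (e2 _ _)).add (e2 _ _)).add (e2 _ _)).add
        (e2 _ _))) (by norm_num),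
      hc_ne 7 (h4.mul ((((e3 _ _ _).add (e3 _ _ _)).add (e3 _ _ _)).add (e3 _ _ _)))
        (by norm_num), hc_ne 8 (h4.mul h4) (by norm_num)]
    simp
  · simp only [sqT, map_mul, aeval_X]
    ring

lemma hit3 (x y z : Fin 7) :
    (X x * X y * X z * (X x * X y + X x * X z + X y * X z) : MvPolynomial (Fin 7) (ZMod 2))
      ∈ hitSub 7 5 := by
  have hX := fun i => isHomogeneous_X (ZMod 2) (i : Fin 7)
  have h3 : (X x * X y * X z : MvPolynomial (Fin 7) (ZMod 2)).IsHomogeneous 3 :=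
    (((hX x).mul (hX y)).mul (hX z))
  have e2 := fun a b => (hX a).mul (hX b)
  refine mem_hit (r := X x * X y * X z + (X x * X y * X z) * (X x + X y + X z)
      + (X x * X y * X z) * (X x * X y * X z)) 3 (by norm_num) h3
    (h3.mul (((e2 _ _).add (e2 _ _)).add (e2 _ _))) ?_ ?_
  · rw [map_add, map_add, hc_ne 3 h3 (by norm_num),
      hc_ne 4 (h3.mul (((hX _).add (hX _)).add (hX _))) (by norm_num),
      hc_ne 6 (h3.mul h3) (by norm_num)]
    simp
  · simp only [sqT, map_mul, aeval_X]
    ring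

lemma hit221 (x y z : Fin 7) :
    (X x ^ 2 * X y ^ 2 * X z : MvPolynomial (Fin 7) (ZMod 2)) ∈ hitSub 7 5 := by
  have h := Submodule.add_mem _ (hit3 x y z) (hit4 z z x y)
  have h2 : (2 : MvPolynomial (Fin 7) (ZMod 2)) = 0 := by
    exact_mod_cast CharP.cast_eq_zero (MvPolynomial (Fin 7) (ZMod 2)) 2
  convert h using 1
  linear_combination (-(X x ^ 2 * X y * X z ^ 2) - X x * X y ^ 2 * X z ^ 2
    - X x * X y * X z ^ 3) * h2

/-- the basis monomials -/
noncomputable def bm (k : K) : MvPolynomial (Fin 7) (ZMod 2) := monomial (ex k.1) 1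

lemma mono_of_good (A : Finset (Fin 7)) (o : Option (Fin 7)) (h : good (A, o)) :
    monomial (ex (A, o)) 1 ∈ hitSub 7 5 ⊔ Submodule.span (ZMod 2) (Set.range bm) :=
  Submodule.mem_sup_right (Submodule.subset_span ⟨⟨(A, o), h⟩, rfl⟩)

lemma ex_some_eq {i a b c : Fin 7} (hab : a ≠ b) (hac : a ≠ c) (hbc : b ≠ c) :
    (monomial (ex ({a, b, c}, some i)) 1 : MvPolynomial (Fin 7) (ZMod 2))
      = X i ^ 2 * X a * X b * X c := by
  rw [X_pow_eq_monomial]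
  simp only [X, monomial_mul, one_mul]
  refine congrArg (fun t => monomial t (1 : ZMod 2)) ?_
  ext j
  simp only [ex_apply, Finsupp.add_apply, Finsupp.single_apply, Finset.mem_insert,
    Finset.mem_singleton, Option.some.injEq]
  by_cases h1 : i = j <;> by_cases h2 : a = j <;> by_cases h3 : b = j <;> by_cases h4 : c = j <;>
    simp_all [eq_comm]

lemma mono_mem (e : Fin 7 →₀ ℕ) (he : e.degree = 5) :
    monomial e 1 ∈ hitSub 7 5 ⊔ Submodule.span (ZMod 2) (Set.range bm) := by
  by_cases h1 : ∃ i a : Fin 7, Finsupp.single i 2 + Finsupp.single a 2 ≤ e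
  · obtain ⟨i, a, h⟩ := h1
    obtain ⟨r, rfl⟩ := exists_add_of_le h
    have hr : r.degree = 1 := by
      simp only [map_add, Finsupp.degree_single] at he; omega
    obtain ⟨c, rfl⟩ : ∃ c, r = Finsupp.single c 1 := by
      have hne : r ≠ 0 := by rintro rfl; simp at hr
      obtain ⟨c, hc⟩ := Finsupp.ne_iff.1 hne
      have hle : Finsupp.single c 1 ≤ r := by
        rw [Finsupp.single_le_iff]; exact Nat.one_le_iff_ne_zero.2 hc
      obtain ⟨s, rfl⟩ := exists_add_of_le hle
      have hs : s.degree = 0 := by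
        simp only [map_add, Finsupp.degree_single] at hr; omega
      rw [(Finsupp.degree_eq_zero_iff s).1 hs]
      exact ⟨c, by simp⟩
    apply Submodule.mem_sup_left
    have := hit221 i a c
    rw [X_pow_eq_monomial, X_pow_eq_monomial] at this
    simpa only [X, monomial_mul, one_mul] using this
  push Not at h1
  set A : Finset (Fin 7) := Finset.univ.filter (fun j => e j % 2 = 1) with hA
  by_cases h2 : ∃ i, 2 ≤ e i
  · obtain ⟨i, hi⟩ := h2
    have hi3 : e i ≤ 3 := by
      by_contra hc
      apply h1 i i
      rw [← Finsupp.single_add]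
      simpa [Finsupp.single_le_iff] using (by omega : 4 ≤ e i)
    have hj : ∀ j, j ≠ i → e j ≤ 1 := by
      intro j hji
      by_contra hc
      apply h1 i j
      intro l
      simp only [Finsupp.add_apply, Finsupp.single_apply]
      by_cases hl : i = l
      · subst hl; simpa [hji] using hi
      · by_cases hl2 : j = l
        · subst hl2; simp [hl]; omega
        · simp [hl, hl2]
    have hex : e = ex (A, some i) := by
      ext j
      simp only [ex_apply, hA, Finset.mem_filter, Finset.mem_univ, true_and, Option.some.injEq]
      by_cases hij : i = j
      · subst hij; simp; split_ifs <;> omega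
      · have := hj j (Ne.symm hij)
        simp [hij]; split_ifs <;> omega
    clear_value A
    subst hex
    have hc : A.card = 3 := by
      rw [degree_ex] at he; simpa using he
    by_cases hg : good (A, some i)
    · exact mono_of_good _ _ hg
    have hg' : i ∉ A ∧ ∀ j ∈ A, i ≤ j := by
      simp only [good, hc] at hg
      simpa using hg
    obtain ⟨a, b, c, hab, hac, hbc, rfl⟩ := Finset.card_eq_three.1 hc
    obtain ⟨hiA, hmin⟩ := hg'
    simp only [Finset.mem_insert, Finset.mem_singleton, not_or] at hiA
    obtain ⟨hia, hib, hic⟩ := hiA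
    have la : i < a := lt_of_le_of_ne (hmin a (by simp)) hia
    have lb : i < b := lt_of_le_of_ne (hmin b (by simp)) hib
    have lc : i < c := lt_of_le_of_ne (hmin c (by simp)) hic
    have key : ∀ p q r : Fin 7, i < p → i ≠ q → i ≠ r → q ≠ r →
        (X p ^ 2 * X i * X q * X r : MvPolynomial (Fin 7) (ZMod 2))
          ∈ hitSub 7 5 ⊔ Submodule.span (ZMod 2) (Set.range bm) := by
      intro p q r hp hq hr hqr
      rw [← ex_some_eq hq hr hqr]
      apply mono_of_good
      refine Or.inr ⟨Finset.card_eq_three.2 ⟨i, q, r, hq, hr, hqr, rfl⟩, p, rfl, Or.inr ⟨i, ?_, hp⟩⟩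
      simp
    rw [ex_some_eq hab hac hbc]
    have h := Submodule.sub_mem _ (Submodule.sub_mem _ (Submodule.sub_mem _
      (Submodule.mem_sup_left (T := Submodule.span (ZMod 2) (Set.range bm)) (hit4 i a b c))
      (key a b c la hib hic hbc)) (key b a c lb hia hic hac)) (key c a b lc hia hib hab)
    convert h using 1
    ring
  · push Not at h2
    have hex : e = ex (A, none) := by
      ext j
      have := h2 j
      simp only [ex_apply, hA, Finset.mem_filter, Finset.mem_univ, true_and]
      simp; split_ifs <;> omega
    clear_value A
    subst hex
    apply mono_of_good
    rw [degree_ex] at he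
    exact Or.inl ⟨rfl, by simpa using he⟩

lemma hom_mem (f : MvPolynomial (Fin 7) (ZMod 2)) (hf : f.IsHomogeneous 5) :
    f ∈ hitSub 7 5 ⊔ Submodule.span (ZMod 2) (Set.range bm) := by
  rw [f.as_sum]
  apply Submodule.sum_mem
  intro d hd
  have h5 : d.degree = 5 := by
    by_contra hne
    exact (mem_support_iff.1 hd) (hf.coeff_eq_zero hne)
  have := Submodule.smul_mem _ (coeff d f) (mono_mem d h5)
  rwa [smul_monomial, smul_eq_mul, mul_one] at this

lemma good_degree (k : K) : (ex k.1).degree = 5 := by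
  obtain ⟨⟨A, o⟩, h⟩ := k
  rw [degree_ex]
  rcases h with ⟨h1, h2⟩ | ⟨h1, i, h2, -⟩
  · simp_all
  · simp_all

lemma bm_hom (k : K) : bm k ∈ homogeneousSubmodule (Fin 7) (ZMod 2) 5 :=
  isHomogeneous_monomial _ (good_degree k)

lemma coeff_comb (c : K → ZMod 2) (k : K) : coeff (ex k.1) (∑ l, c l • bm l) = c k := by
  rw [coeff_sum, Finset.sum_eq_single k]
  · simp [bm]
  · intro l _ hl
    simp only [bm, coeff_smul, coeff_monomial]
    rw [if_neg]
    · simp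
    · intro h; exact hl (Subtype.ext (ex_inj h))
  · simp

lemma coeff_comb' (c : K → ZMod 2) (p) (hp : ¬ good p) :
    coeff (ex p) (∑ l, c l • bm l) = 0 := by
  rw [coeff_sum]
  apply Finset.sum_eq_zero
  intro l _
  simp only [bm, coeff_smul, coeff_monomial]
  rw [if_neg]
  · simp
  · intro h; exact hp (ex_inj h ▸ l.2)

lemma indep (c : K → ZMod 2) (h : ∑ l, c l • bm l ∈ hitSub 7 5) (k : K) : c k = 0 := by
  have hd := good_degree k
  rw [← coeff_comb c k]
  obtain ⟨⟨A, o⟩, hk⟩ := k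
  by_cases hs : ∀ j, ex (A, o) j = 0 ∨ ex (A, o) j = 1 ∨ ex (A, o) j = 3
  · exact hit_spike _ hd hs _ h
  rcases hk with ⟨h1, h2⟩ | ⟨h1, i, h2, h3⟩
  · exfalso
    apply hs
    intro j
    simp only at h1
    subst h1
    simp only [ex_apply]
    split_ifs <;> simp_all
  · simp only at h1 h2 h3
    subst h2
    have hiA : i ∉ A := by
      intro hiA
      apply hs
      intro j
      simp only [ex_apply, Option.some.injEq]
      split_ifs <;> simp_all
    obtain ⟨j, hj, hji⟩ := h3.resolve_left hiA
    have hne : A.Nonempty := ⟨j, hj⟩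
    set m := A.min' hne with hm
    have hmA : m ∈ A := A.min'_mem hne
    have hmi : m < i := lt_of_le_of_lt (A.min'_le j hj) hji
    have hmin : ∀ l ∈ A, m ≤ l := fun l hl => A.min'_le l hl
    have hi' : i ∉ A.erase m := fun hh => hiA (Finset.mem_of_mem_erase hh)
    have hB : (insert i (A.erase m)).card = 3 := by
      rw [Finset.card_insert_of_notMem hi', Finset.card_erase_of_mem hmA, h1]
    have hmB : m ∉ insert i (A.erase m) := by
      simp [hmi.ne]
    have hins : insert i A = insert m (insert i (A.erase m)) := by
      rw [Finset.insert_comm, Finset.insert_erase hmA]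
    rw [hit_two A (insert i (A.erase m)) i m hiA hmB h1 hB hins _ h]
    apply coeff_comb'
    rintro (⟨h4, -⟩ | ⟨-, i', h4, h5⟩)
    · simp at h4
    · simp only [Option.some.injEq] at h4
      subst h4
      rcases h5 with h5 | ⟨l, hl, hlm⟩
      · exact hmB h5
      · rcases Finset.mem_insert.1 hl with rfl | hl
        · exact absurd hlm (not_lt.2 hmi.le)
        · exact absurd hlm (not_lt.2 (hmin l (Finset.mem_of_mem_erase hl)))

/-- classes of the basis monomials -/
noncomputable def bv (k : K) : QP 7 5 := Submodule.Quotient.mk ⟨bm k, bm_hom k⟩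

lemma comb_bv (c : K → ZMod 2) : ∑ k, c k • bv k = 
    (Submodule.Quotient.mk (∑ k, c k • (⟨bm k, bm_hom k⟩ :
      homogeneousSubmodule (Fin 7) (ZMod 2) 5)) : QP 7 5) := by
  simp only [bv, ← Submodule.mkQ_apply, map_sum, map_smul]

lemma bv_li : LinearIndependent (ZMod 2) bv := by
  rw [Fintype.linearIndependent_iff]
  intro c hc
  rw [comb_bv, Submodule.Quotient.mk_eq_zero, Submodule.mem_comap] at hc
  apply indep c
  simpa using hc

lemma bv_span : ⊤ ≤ Submodule.span (ZMod 2) (Set.range bv) := by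
  intro q _
  obtain ⟨⟨f, hf⟩, rfl⟩ := Submodule.Quotient.mk_surjective _ q
  obtain ⟨y, hy, z, hz, hyz⟩ := Submodule.mem_sup.1 (hom_mem f hf)
  obtain ⟨c, rfl⟩ := (Submodule.mem_span_range_iff_exists_fun _).1 hz
  rw [Submodule.mem_span_range_iff_exists_fun]
  refine ⟨c, ?_⟩
  rw [comb_bv, eq_comm, Submodule.Quotient.eq, Submodule.mem_comap]
  simpa [← hyz] using hy

end QPaux

/-- The cohit space `QP_5^{⊗7}` has dimension 231 over `F2`. -/
theorem dim_QP_7_5 : Module.finrank (ZMod 2) (QP 7 5) = 231 := by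
  rw [Module.finrank_eq_card_basis (Module.Basis.mk QPaux.bv_li QPaux.bv_span), QPaux.card_K]
end

section
/- In F2[t_1, ..., t_6] with the Steenrod algebra action, the cohit space QP_13^{⊗6} (degree-13 homogeneous polynomials modulo hit elements) has dimension 1294 over F2 (correcting the previously published value 1303). -/
open MvPolynomial

namespace Hit613

/-! ### Kernel-friendly Gaussian elimination over `F2`, vectors being natural numbers

Everything is written with bare recursors, so that the kernel evaluates it quickly. -/

/-- A binary search tree whose leaves hold the rows of an echelon basis; at `node m l r`
the rows with leading bit below `m` are on the left. -/
inductive RowTree where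
  | nil : RowTree
  | leaf (v : ℕ) : RowTree
  | node (m : ℕ) (l r : RowTree) : RowTree

/-- A list of lists of exponents, together with packed tables. -/
inductive Factors where
  | nil : Factors
  | cons (p : List ℕ) (b : ℕ) (t : Factors) : Factors

/-- Evaluate a natural number to a literal before passing it on. -/
noncomputable def force {α : Type} (n : ℕ) (k : ℕ → α) : α :=
  Nat.rec (k 0) (fun m _ => k (Nat.succ m)) n

/-- Branching on a Boolean. -/
noncomputable def ite' {α : Type} (b : Bool) (x y : α) : α :=
  Bool.rec y x b

/-- The row stored for the leading bit of `v` (or `0`). -/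
noncomputable def lookup (t : RowTree) (v : ℕ) : ℕ :=
  RowTree.rec 0 (fun w => w) (fun m _ _ l r => Bool.rec l r (Nat.ble (Nat.pow 2 m) v)) t

/-- Insert the row `v`. -/
noncomputable def insK (d m h : ℕ) (t : RowTree) (v : ℕ) (k : RowTree → RowTree) : RowTree :=
  Nat.rec (motive := fun _ => ℕ → ℕ → RowTree → (RowTree → RowTree) → RowTree)
    (fun _ _ t k =>
      RowTree.rec (k (.leaf v)) (fun w => k (.node 0 (.leaf v) (.leaf w)))
        (fun m l r _ _ => k (.node 0 (.leaf v) (.node m l r))) t)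
    (fun _ ih m h t k =>
      RowTree.rec
        (force (Nat.div h 2) fun h' =>
          ite' (Nat.ble (Nat.pow 2 m) v)
            (force (Nat.add m h) fun m' => ih m' h' .nil fun r => k (.node m .nil r))
            (force (Nat.sub m h) fun m' => ih m' h' .nil fun l => k (.node m l .nil)))
        (fun w => k (.node 0 (.leaf v) (.leaf w)))
        (fun n l r _ _ => force (Nat.div h 2) fun h' =>
          ite' (Nat.ble (Nat.pow 2 n) v)
            (force (Nat.add m h) fun m' => ih m' h' r fun r' => k (.node n l r'))
            (force (Nat.sub m h) fun m' => ih m' h' l fun l' => k (.node n l' r))) t)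
    d m h t k

/-- Reduce `v` against the rows of the tree, inserting what remains. -/
noncomputable def red (f : ℕ) (t : RowTree) (v : ℕ) : RowTree :=
  Nat.rec (motive := fun _ => ℕ → RowTree)
    (fun v => insK 14 8256 4096 t v fun t => t)
    (fun _ ih v =>
      Nat.rec t
        (fun w _ =>
          Nat.rec (insK 14 8256 4096 t (Nat.succ w) fun t => t)
            (fun u _ => ih (Nat.xor (Nat.succ w) (Nat.succ u)))
            (lookup t (Nat.succ w))) v)
    f v

/-- Run `f (n-1), …, f 0` on the tree. -/
noncomputable def forE (f : ℕ → RowTree → RowTree) (n : ℕ) (t : RowTree) : RowTree :=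
  Nat.rec (motive := fun _ => RowTree → RowTree) (fun t => t)
    (fun n ih t => RowTree.rec (ih .nil) (fun v => ih (.leaf v))
      (fun m l r _ _ => ih (.node m l r)) (f n t)) n t

/-- Exponents occurring in `(x + x^2)^a` over `F2`, for `a ≤ 12`. -/
def powTbl : List (List ℕ) :=
  [[0],
   [1, 2],
   [2, 4],
   [3, 4, 5, 6],
   [4, 8],
   [5, 6, 9, 10],
   [6, 8, 10, 12],
   [7, 8, 9, 10, 11, 12, 13, 14],
   [8, 16],
   [9, 10, 17, 18],
   [10, 12, 18, 20],
   [11, 12, 13, 14, 19, 20, 21, 22],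
   [12, 16, 20, 24]]

/-- Exponents occurring in `(x + x^2)^a`. -/
def powL (a : ℕ) : List ℕ := powTbl.getD a []

/-- Packed tables of `C(r + m - 1, m)` for `r ≤ 13` and `m = 5, 4, 3, 2, 1, 0`. -/
def binTbl : List ℕ :=
  [2545622968843919099016559540291738678211218574177653630174660460544,
   748713141920895349259885458380331894440427948531859572766940397568,
   187178428287712547373943420677123866157241988424814327131698954240,
   37435718299314422109790518619387890047000835753550326251697274880,
   5347965137568349576735197201017070780371342271464875447623417856,
   0]

/-- The packed table number `n`. -/
def binT (n : ℕ) : ℕ := binTbl.getD n 0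

/-- Read a packed table. -/
def tab (B r : ℕ) : ℕ := Nat.mod (Nat.shiftRight B (Nat.mul 16 r)) 65536

/-- The bit vector of the monomial number `n`: the bit `n + 64`, and a signature in the lowest
`64` bits (which serves only to avoid hash collisions between numbers with equal low bits). -/
def code (n : ℕ) : ℕ :=
  Nat.add (Nat.pow 2 (Nat.add n 64)) (Nat.mod (Nat.mul n 11400714819323198485) (Nat.pow 2 64))

/-- The bit vector of the degree `r` part of a product of one-variable polynomials. -/
noncomputable def gen (ps : Factors) (r acc : ℕ) : ℕ :=
  Factors.rec (motive := fun _ => ℕ → ℕ → ℕ)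
    (fun r acc => Nat.rec (code acc) (fun _ _ => 0) r)
    (fun p b _ ih r acc =>
      List.rec 0 (fun e _ v => ite' (Nat.ble e r)
        (Nat.xor v (force (Nat.sub r e) fun r' =>
          force (Nat.add acc (tab b r')) fun acc' => ih r' acc')) v) p)
    ps r acc

/-- Insert the total squares of all monomials in `n` more variables of degree at most `r`. -/
noncomputable def iter (n r : ℕ) (ps : Factors) (t : RowTree) : RowTree :=
  Nat.rec (motive := fun _ => ℕ → Factors → RowTree → RowTree)
    (fun _ ps t => red 100 t (gen ps 13 0))
    (fun n ih r ps t =>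
      force (binT n) fun b =>
        forE (fun e t => force (Nat.sub r e) fun r' => ih r' (.cons (powL e) b ps) t) (Nat.succ r) t)
    n r ps t

/-- All rows are in `[lo, hi)`, with powers of two separating any two of them. -/
noncomputable def good (t : RowTree) (lo hi : ℕ) : Bool :=
  RowTree.rec (motive := fun _ => ℕ → ℕ → Bool) (fun _ _ => true)
    (fun v lo hi => and (Nat.ble (Nat.pow 2 lo) v) (Nat.ble (Nat.succ v) (Nat.pow 2 hi)))
    (fun m _ _ l r lo hi =>
      and (and (Nat.ble lo m) (Nat.ble m hi)) (and (l lo m) (r m hi))) t lo hi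

/-- Number of rows. -/
noncomputable def count (t : RowTree) : ℕ :=
  RowTree.rec 0 (fun _ => 1) (fun _ _ _ l r => Nat.add l r) t

/-- Final test of the tree. -/
noncomputable def test (t : RowTree) (n : ℕ) : Bool :=
  RowTree.rec false (fun _ => false)
    (fun m l r _ _ => and (good (.node m l r) 0 16448)
      (Nat.beq (count (.node m l r)) n)) t

/-! ### Correctness of the elimination -/

/-- The vector of bits of a natural number. -/
def bits (v : ℕ) : ℕ → ZMod 2 := fun i => if v.testBit i then 1 else 0

theorem bits_zero : bits 0 = 0 := by
  funext i; simp [bits]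

theorem bits_xor (v w : ℕ) : bits (Nat.xor v w) = bits v + bits w := by
  funext i
  have h : (Nat.xor v w).testBit i = (v.testBit i ^^ w.testBit i) := Nat.testBit_xor v w i
  simp only [bits, h, Pi.add_apply]
  cases v.testBit i <;> cases w.testBit i <;> decide

theorem force_eq {α : Type} (n : ℕ) (k : ℕ → α) : force n k = k n := by
  cases n <;> rfl

/-- The span of the rows. -/
noncomputable def Sp (t : RowTree) : Submodule (ZMod 2) (ℕ → ZMod 2) :=
  RowTree.rec ⊥ (fun v => Submodule.span (ZMod 2) {bits v}) (fun _ _ _ l r => l ⊔ r) t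

theorem Sp_nil : Sp .nil = ⊥ := rfl
theorem Sp_leaf (v : ℕ) : Sp (.leaf v) = Submodule.span (ZMod 2) {bits v} := rfl
theorem Sp_node (m : ℕ) (l r : RowTree) : Sp (.node m l r) = Sp l ⊔ Sp r := rfl

theorem lookup_mem (t : RowTree) (v : ℕ) : bits (lookup t v) ∈ Sp t := by
  induction t with
  | nil => exact (Submodule.mem_bot _).2 bits_zero
  | leaf w => exact Submodule.mem_span_singleton_self _
  | node m l r hl hr =>
    have h : lookup (.node m l r) v = Bool.rec (lookup l v) (lookup r v) (Nat.ble (Nat.pow 2 m) v) :=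
      rfl
    rw [h, Sp_node]
    cases Nat.ble (Nat.pow 2 m) v
    · exact Submodule.mem_sup_left hl
    · exact Submodule.mem_sup_right hr

theorem insK_spec (v : ℕ) (P : RowTree → Prop) (d : ℕ) : ∀ (m h : ℕ) (t : RowTree)
    (k : RowTree → RowTree)
    (_ : ∀ s, Sp s = Sp t ⊔ Submodule.span (ZMod 2) {bits v} → P (k s)), P (insK d m h t v k) := by
  induction d with
  | zero =>
    intro m h t k hk
    cases t with
    | nil => exact hk _ (by rw [Sp_nil, Sp_leaf, bot_sup_eq])
    | leaf w => exact hk _ (by rw [Sp_node, Sp_leaf, Sp_leaf, sup_comm])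
    | node m l r => exact hk _ (by rw [Sp_node, Sp_leaf, sup_comm])
  | succ d ih =>
    intro m h t k hk
    cases t with
    | nil =>
      have e : insK (d + 1) m h .nil v k = force (Nat.div h 2) fun h' =>
          ite' (Nat.ble (Nat.pow 2 m) v)
            (force (Nat.add m h) fun m' => insK d m' h' .nil v fun r => k (.node m .nil r))
            (force (Nat.sub m h) fun m' => insK d m' h' .nil v fun l => k (.node m l .nil)) := rfl
      rw [e]
      simp only [force_eq]
      cases Nat.ble (Nat.pow 2 m) v
      · refine ih _ _ _ _ fun s hs => hk _ ?_
        rw [Sp_node, hs, Sp_nil, sup_bot_eq]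
      · refine ih _ _ _ _ fun s hs => hk _ ?_
        rw [Sp_node, hs, Sp_nil, bot_sup_eq]
    | leaf w => exact hk _ (by rw [Sp_node, Sp_leaf, Sp_leaf, sup_comm])
    | node n l r =>
      have e : insK (d + 1) m h (.node n l r) v k = force (Nat.div h 2) fun h' =>
          ite' (Nat.ble (Nat.pow 2 n) v)
            (force (Nat.add m h) fun m' => insK d m' h' r v fun r' => k (.node n l r'))
            (force (Nat.sub m h) fun m' => insK d m' h' l v fun l' => k (.node n l' r)) := rfl
      rw [e]
      simp only [force_eq]
      cases Nat.ble (Nat.pow 2 n) v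
      · refine ih _ _ _ _ fun s hs => hk _ ?_
        rw [Sp_node, hs, Sp_node, sup_right_comm]
      · refine ih _ _ _ _ fun s hs => hk _ ?_
        rw [Sp_node, hs, Sp_node, sup_assoc]

theorem red_spec (t : RowTree) (f : ℕ) : ∀ v,
    Sp (red f t v) = Sp t ⊔ Submodule.span (ZMod 2) {bits v} := by
  induction f with
  | zero =>
    intro v
    exact insK_spec v (fun s => Sp s = Sp t ⊔ Submodule.span (ZMod 2) {bits v}) 14 8256 4096 t
      (fun t => t) fun s hs => hs
  | succ f ih =>
    intro v
    cases v with
    | zero =>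
      have e : red (f + 1) t 0 = t := rfl
      rw [e, bits_zero, Submodule.span_zero_singleton, sup_bot_eq]
    | succ w =>
      have e : red (f + 1) t (w + 1) = Nat.rec (insK 14 8256 4096 t (Nat.succ w) fun t => t)
            (fun u _ => red f t (Nat.xor (Nat.succ w) (Nat.succ u)))
            (lookup t (Nat.succ w)) := rfl
      rw [e]
      have hm := lookup_mem t (Nat.succ w)
      generalize lookup t (Nat.succ w) = u at hm
      cases u with
      | zero =>
        exact insK_spec (w + 1) (fun s => Sp s = Sp t ⊔ Submodule.span (ZMod 2) {bits (w + 1)})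
          _ _ _ _ _ fun s hs => hs
      | succ u =>
        refine (ih _).trans ?_
        rw [bits_xor]
        apply le_antisymm
        · refine sup_le le_sup_left ?_
          rw [Submodule.span_singleton_le_iff_mem]
          exact Submodule.add_mem _
            (Submodule.mem_sup_right (Submodule.mem_span_singleton_self _))
            (Submodule.mem_sup_left hm)
        · refine sup_le le_sup_left ?_
          rw [Submodule.span_singleton_le_iff_mem]
          have h := Submodule.sub_mem (Sp t ⊔ Submodule.span (ZMod 2) {bits (w + 1) + bits (u + 1)})
            (Submodule.mem_sup_right (Submodule.mem_span_singleton_self _))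
            (Submodule.mem_sup_left hm)
          rwa [add_sub_cancel_right] at h

theorem forE_spec (f : ℕ → RowTree → RowTree) (A : ℕ → Submodule (ZMod 2) (ℕ → ZMod 2))
    (hf : ∀ e t, Sp (f e t) = Sp t ⊔ A e) (n : ℕ) : ∀ t,
    Sp (forE f n t) = Sp t ⊔ ⨆ e, ⨆ (_ : e < n), A e := by
  induction n with
  | zero =>
    intro t
    have e : forE f 0 t = t := rfl
    simp [e]
  | succ n ih =>
    intro t
    have e : forE f (n + 1) t = forE f n (f n t) := by
      change RowTree.rec (motive := fun _ => RowTree) (forE f n .nil) (fun v => forE f n (.leaf v))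
        (fun m l r _ _ => forE f n (.node m l r)) (f n t) = _
      cases f n t <;> rfl
    rw [e, ih, hf, Nat.iSup_lt_succ, sup_assoc, sup_comm (A n)]

/-- The span of the vectors inserted by `iter`. -/
noncomputable def spanGen : ℕ → ℕ → Factors → Submodule (ZMod 2) (ℕ → ZMod 2)
  | 0, _, ps => Submodule.span (ZMod 2) {bits (gen ps 13 0)}
  | n + 1, r, ps => ⨆ e, ⨆ (_ : e < r + 1), spanGen n (r - e) (.cons (powL e) (binT n) ps)

theorem iter_spec (n : ℕ) : ∀ (r : ℕ) (ps : Factors) (t : RowTree),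
    Sp (iter n r ps t) = Sp t ⊔ spanGen n r ps := by
  induction n with
  | zero => intro r ps t; exact red_spec t 100 (gen ps 13 0)
  | succ n ih =>
    intro r ps t
    have e : iter (n + 1) r ps t = force (binT n) fun b =>
        forE (fun e t => force (Nat.sub r e) fun r' => iter n r' (.cons (powL e) b ps) t)
          (Nat.succ r) t := rfl
    rw [e]
    simp only [force_eq]
    exact forE_spec _ (fun e => spanGen n (r - e) (.cons (powL e) (binT n) ps))
      (fun e t => ih _ _ _) _ _

/-! ### The rows are independent -/

/-- Vectors vanishing from `n` on. -/
def low (n : ℕ) : Submodule (ZMod 2) (ℕ → ZMod 2) where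
  carrier := {x | ∀ j, n ≤ j → x j = 0}
  add_mem' := by
    intro a b ha hb j hj
    simp [ha j hj, hb j hj]
  zero_mem' := by intro j _; rfl
  smul_mem' := by
    intro c a ha j hj
    simp [ha j hj]

theorem low_mono {m n : ℕ} (h : m ≤ n) : low m ≤ low n :=
  fun _ hx j hj => hx j (h.trans hj)

theorem good_spec (t : RowTree) : ∀ lo hi, good t lo hi = true →
    Module.Finite (ZMod 2) (Sp t) ∧ Module.finrank (ZMod 2) (Sp t) = count t ∧ Sp t ≤ low hi ∧
      ∀ x ∈ Sp t, x ∈ low lo → x = 0 := by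
  induction t with
  | nil =>
    intro lo hi _
    rw [Sp_nil]
    exact ⟨inferInstance, finrank_bot _ _, bot_le, fun x hx _ => (Submodule.mem_bot _).1 hx⟩
  | leaf v =>
    intro lo hi h
    have h' : (Nat.ble (Nat.pow 2 lo) v && Nat.ble (Nat.succ v) (Nat.pow 2 hi)) = true := h
    rw [Bool.and_eq_true] at h'
    have h1 : 2 ^ lo ≤ v := Nat.le_of_ble_eq_true h'.1
    have h2 : v < 2 ^ hi := Nat.le_of_ble_eq_true h'.2
    have hn : bits v ∉ low lo := by
      intro hb
      have : v < 2 ^ lo := by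
        apply Nat.lt_pow_two_of_testBit
        intro i hi
        have := hb i hi
        by_contra hc
        simp [bits, hc] at this
      omega
    have hz : bits v ≠ 0 := fun h0 => hn (h0 ▸ Submodule.zero_mem _)
    rw [Sp_leaf]
    refine ⟨inferInstance, finrank_span_singleton hz, ?_, ?_⟩
    · rw [Submodule.span_singleton_le_iff_mem]
      intro j hj
      have : v.testBit j = false :=
        Nat.testBit_lt_two_pow (lt_of_lt_of_le h2 (Nat.pow_le_pow_right (by norm_num) hj))
      simp [bits, this]
    · intro x hx hl
      obtain ⟨c, rfl⟩ := Submodule.mem_span_singleton.1 hx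
      by_cases hc : c = 0
      · rw [hc, zero_smul]
      · exact absurd ((Submodule.smul_mem_iff _ hc).1 hl) hn
  | node m l r hl hr =>
    intro lo hi h
    have h' : ((Nat.ble lo m && Nat.ble m hi) && (good l lo m && good r m hi)) = true := h
    simp only [Bool.and_eq_true] at h'
    obtain ⟨⟨h1, h2⟩, h3, h4⟩ := h'
    have h1 : lo ≤ m := Nat.le_of_ble_eq_true h1
    have h2 : m ≤ hi := Nat.le_of_ble_eq_true h2
    obtain ⟨fl, cl, ll, il⟩ := hl _ _ h3
    obtain ⟨fr, cr, lr, ir⟩ := hr _ _ h4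
    rw [Sp_node]
    refine ⟨inferInstance, ?_, sup_le (ll.trans (low_mono h2)) lr, ?_⟩
    · have hc : count (.node m l r) = count l + count r := rfl
      have hi : Sp l ⊓ Sp r = ⊥ := by
        rw [eq_bot_iff]
        intro x hx
        exact (Submodule.mem_bot _).2 (ir x hx.2 (ll hx.1))
      have := Submodule.finrank_sup_add_finrank_inf_eq (Sp l) (Sp r)
      rw [hi, finrank_bot, cl, cr, add_zero] at this
      rw [this, hc]
    · intro x hx hlo
      obtain ⟨a, ha, b, hb, rfl⟩ := Submodule.mem_sup.1 hx
      have hb0 : b = 0 := by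
        refine ir b hb ?_
        have := Submodule.sub_mem _ (low_mono h1 hlo) (ll ha)
        simpa using this
      subst hb0
      rw [add_zero] at hlo ⊢
      exact il a ha hlo

theorem test_spec (t : RowTree) (n : ℕ) (h : test t n = true) :
    Module.finrank (ZMod 2) (Sp t) = n := by
  cases t with
  | nil => exact absurd h (by intro h; cases h)
  | leaf v => exact absurd h (by intro h; cases h)
  | node m l r =>
    have h' : (good (.node m l r) 0 16448 && Nat.beq (count (.node m l r)) n) = true := h
    rw [Bool.and_eq_true] at h'
    rw [(good_spec _ _ _ h'.1).2.1]
    exact Nat.eq_of_beq_eq_true h'.2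

/-! ### Numbering of the monomials -/

theorem tab_eq (n : ℕ) (hn : n < 5) (r : ℕ) (hr : r ≤ 13) :
    tab (binT n) r = (r + 4 - n).choose (5 - n) := by
  have h : ∀ n < 5, ∀ r < 14, tab (binT n) r = (r + 4 - n).choose (5 - n) := by decide +kernel
  exact h n hn r (by omega)

theorem tab_last (r : ℕ) : tab (binT 5) r = 0 := by
  change (0 >>> (16 * r)) % 65536 = 0
  simp

/-- The number of the monomial with exponents `x5, …, x0`. -/
def num (x5 x4 x3 x2 x1 x0 : ℕ) : ℕ :=
  0 + tab (binT 0) (13 - x5) + tab (binT 1) (13 - x5 - x4) + tab (binT 2) (13 - x5 - x4 - x3) +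
    tab (binT 3) (13 - x5 - x4 - x3 - x2) + tab (binT 4) (13 - x5 - x4 - x3 - x2 - x1) +
    tab (binT 5) (13 - x5 - x4 - x3 - x2 - x1 - x0)

theorem choose_split {a b k s t : ℕ} (hs : s < a.choose k) (ht : t < b.choose k)
    (h : a.choose (k + 1) + s = b.choose (k + 1) + t) : a = b ∧ s = t := by
  have key : ∀ {a b s t : ℕ}, s < a.choose k → a < b →
      a.choose (k + 1) + s < b.choose (k + 1) + t := by
    intro a b s t hs hab
    have h1 : (a + 1).choose (k + 1) ≤ b.choose (k + 1) := Nat.choose_le_choose _ hab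
    rw [Nat.choose_succ_succ'] at h1
    omega
  rcases lt_trichotomy a b with hab | hab | hab
  · have := key (t := t) hs hab; omega
  · subst hab; exact ⟨rfl, by omega⟩
  · have := key (t := s) ht hab; omega

theorem choose_bound {a c k s : ℕ} (hs : s < a.choose k) (hac : a < c) :
    a.choose (k + 1) + s < c.choose (k + 1) := by
  have h1 : (a + 1).choose (k + 1) ≤ c.choose (k + 1) := Nat.choose_le_choose _ hac
  rw [Nat.choose_succ_succ'] at h1
  omega

theorem num_eq (x5 x4 x3 x2 x1 x0 : ℕ) :
    num x5 x4 x3 x2 x1 x0 = (13 - x5 + 4).choose 5 + ((13 - x5 - x4 + 3).choose 4 +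
      ((13 - x5 - x4 - x3 + 2).choose 3 + ((13 - x5 - x4 - x3 - x2 + 1).choose 2 +
        ((13 - x5 - x4 - x3 - x2 - x1).choose 1 + 0)))) := by
  unfold num
  rw [tab_eq 0 (by omega) _ (by omega), tab_eq 1 (by omega) _ (by omega),
    tab_eq 2 (by omega) _ (by omega), tab_eq 3 (by omega) _ (by omega),
    tab_eq 4 (by omega) _ (by omega), tab_last]
  simp only [Nat.reduceSub, Nat.reduceAdd, Nat.sub_zero, zero_add, add_zero,
    Nat.add_sub_cancel, add_assoc, Nat.add_succ_sub_one,
    show ∀ n, n + 4 - 2 = n + 2 by omega, show ∀ n, n + 4 - 3 = n + 1 by omega]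

theorem num_inj {x5 x4 x3 x2 x1 x0 y5 y4 y3 y2 y1 y0 : ℕ}
    (hx : x5 + x4 + x3 + x2 + x1 + x0 = 13) (hy : y5 + y4 + y3 + y2 + y1 + y0 = 13)
    (h : num x5 x4 x3 x2 x1 x0 = num y5 y4 y3 y2 y1 y0) :
    x5 = y5 ∧ x4 = y4 ∧ x3 = y3 ∧ x2 = y2 ∧ x1 = y1 ∧ x0 = y0 := by
  rw [num_eq, num_eq] at h
  have b1 (a : ℕ) : 0 < a.choose 0 := by simp
  have b2 (x5 x4 x3 x2 x1 : ℕ) := choose_bound (b1 (13 - x5 - x4 - x3 - x2 - x1))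
    (show _ < 13 - x5 - x4 - x3 - x2 + 1 by omega)
  have b3 (x5 x4 x3 x2 x1 : ℕ) := choose_bound (b2 x5 x4 x3 x2 x1)
    (show _ < 13 - x5 - x4 - x3 + 2 by omega)
  have b4 (x5 x4 x3 x2 x1 : ℕ) := choose_bound (b3 x5 x4 x3 x2 x1)
    (show _ < 13 - x5 - x4 + 3 by omega)
  have b5 (x5 x4 x3 x2 x1 : ℕ) := choose_bound (b4 x5 x4 x3 x2 x1)
    (show _ < 13 - x5 + 4 by omega)
  obtain ⟨h5, h⟩ := choose_split (b5 _ _ _ _ _) (b5 _ _ _ _ _) h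
  obtain ⟨h4, h⟩ := choose_split (b4 _ _ _ _ _) (b4 _ _ _ _ _) h
  obtain ⟨h3, h⟩ := choose_split (b3 _ _ _ _ _) (b3 _ _ _ _ _) h
  obtain ⟨h2, h⟩ := choose_split (b2 _ _ _ _ _) (b2 _ _ _ _ _) h
  obtain ⟨h1, h⟩ := choose_split (b1 _) (b1 _) h
  omega

theorem bits_code (n i : ℕ) : bits (code n) (i + 64) = if i = n then 1 else 0 := by
  have h : code n = 2 ^ 64 * 2 ^ n + (n * 11400714819323198485) % 2 ^ 64 := by
    rw [← pow_add, add_comm 64 n]; rfl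
  unfold bits
  rw [h, Nat.testBit_two_pow_mul_add _ (Nat.mod_lt _ (by positivity))]
  simp [Nat.testBit_two_pow, eq_comm]

/-! ### The linear map to bit vectors -/

/-- Number of a monomial. -/
def idx (d : Fin 6 →₀ ℕ) : ℕ := num (d 5) (d 4) (d 3) (d 2) (d 1) (d 0)

/-- The linear map sending a monomial to its bit vector. -/
noncomputable def Psi : MvPolynomial (Fin 6) (ZMod 2) →ₗ[ZMod 2] (ℕ → ZMod 2) :=
  (basisMonomials (Fin 6) (ZMod 2)).constr (ZMod 2) fun d => bits (code (idx d))

theorem Psi_monomial (d : Fin 6 →₀ ℕ) : Psi (monomial d 1) = bits (code (idx d)) := by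
  have := (basisMonomials (Fin 6) (ZMod 2)).constr_basis (ZMod 2)
    (fun d => bits (code (idx d))) d
  rwa [coe_basisMonomials] at this

theorem monomial_smul_one (d : Fin 6 →₀ ℕ) (c : ZMod 2) :
    monomial d c = c • monomial d (1 : ZMod 2) := by
  rw [smul_monomial, smul_eq_mul, mul_one]

theorem degree_six (d : Fin 6 →₀ ℕ) :
    d.degree = d 5 + d 4 + d 3 + d 2 + d 1 + d 0 := by
  rw [Finsupp.degree_eq_sum, Fin.sum_univ_six]
  omega

theorem idx_inj {d e : Fin 6 →₀ ℕ} (hd : d.degree = 13) (he : e.degree = 13)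
    (h : idx d = idx e) : d = e := by
  rw [degree_six] at hd he
  obtain ⟨h5, h4, h3, h2, h1, h0⟩ := num_inj hd he h
  ext i
  fin_cases i <;> assumption

theorem Psi_inj (p : MvPolynomial (Fin 6) (ZMod 2)) (hp : p.IsHomogeneous 13)
    (h : Psi p = 0) : p = 0 := by
  ext e
  rw [coeff_zero]
  by_contra hc
  have hs : e ∈ p.support := mem_support_iff.2 hc
  have hdeg : ∀ d ∈ p.support, d.degree = 13 := fun d hd => by
    have := hp (mem_support_iff.1 hd)
    rw [Finsupp.degree_eq_weight_one]
    exact this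
  have h1 : Psi p (idx e + 64) = coeff e p := by
    conv_lhs => rw [p.as_sum]
    rw [map_sum, Finset.sum_apply, Finset.sum_eq_single e]
    · rw [monomial_smul_one, map_smul, Psi_monomial, Pi.smul_apply, bits_code]
      simp
    · intro d hd hde
      rw [monomial_smul_one, map_smul, Psi_monomial, Pi.smul_apply, bits_code, if_neg, smul_zero]
      intro hi
      exact hde (idx_inj (hdeg d hd) (hdeg e hs) hi.symm)
    · intro hn; exact absurd hs hn
  rw [h] at h1
  exact hc h1.symm

/-! ### The total squares of monomials -/

theorem pow_tbl {R : Type*} [CommRing R] [CharP R 2] (x : R) (a : ℕ) (ha : a ≤ 12) :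
    (x + x ^ 2) ^ a = ((powL a).map fun e => x ^ e).sum := by
  have h2 : (2 : R) = 0 := CharTwo.two_eq_zero
  have e2 : (x + x ^ 2) ^ 2 = x ^ 2 + x ^ 4 := by linear_combination x ^ 3 * h2
  have e4 : (x + x ^ 2) ^ 4 = x ^ 4 + x ^ 8 := by
    rw [show 4 = 2 * 2 from rfl, pow_mul, e2]; linear_combination x ^ 6 * h2
  have e8 : (x + x ^ 2) ^ 8 = x ^ 8 + x ^ 16 := by
    rw [show 8 = 4 * 2 from rfl, pow_mul, e4]; linear_combination x ^ 12 * h2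
  interval_cases a <;> simp only [powL, powTbl, List.getD_cons_zero, List.getD_cons_succ,
    List.map_cons, List.map_nil, List.sum_cons, List.sum_nil]
  · ring
  · ring
  · rw [e2]; ring
  · rw [show 3 = 2 + 1 from rfl, pow_add, e2]; ring
  · rw [e4]; ring
  · rw [show 5 = 4 + 1 from rfl, pow_add, e4]; ring
  · rw [show 6 = 4 + 2 from rfl, pow_add, e4, e2]; ring
  · rw [show 7 = 4 + 2 + 1 from rfl, pow_add, pow_add, e4, e2]; ring
  · rw [e8]; ring
  · rw [show 9 = 8 + 1 from rfl, pow_add, e8]; ring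
  · rw [show 10 = 8 + 2 from rfl, pow_add, e8, e2]; ring
  · rw [show 11 = 8 + 2 + 1 from rfl, pow_add, pow_add, e8, e2]; ring
  · rw [show 12 = 8 + 4 from rfl, pow_add, e8, e4]; ring

/-- Degree 13 part, as a bit vector. -/
noncomputable def LL : MvPolynomial (Fin 6) (ZMod 2) →ₗ[ZMod 2] (ℕ → ZMod 2) :=
  Psi ∘ₗ homogeneousComponent 13

theorem LL_mul_sum (m q : MvPolynomial (Fin 6) (ZMod 2)) (l : List ℕ)
    (f : ℕ → MvPolynomial (Fin 6) (ZMod 2)) :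
    LL (m * ((l.map f).sum * q)) = (l.map fun x => LL ((m * f x) * q)).sum := by
  rw [← List.sum_map_mul_right, ← List.sum_map_mul_left, map_list_sum, List.map_map]
  simp only [Function.comp_def, mul_assoc]

theorem LL_monomial (x5 x4 x3 x2 x1 x0 : ℕ) :
    LL ((((((1 * X 5 ^ x5) * X 4 ^ x4) * X 3 ^ x3) * X 2 ^ x2) * X 1 ^ x1) * X 0 ^ x0 * 1) =
      if x5 + x4 + x3 + x2 + x1 + x0 = 13 then bits (code (num x5 x4 x3 x2 x1 x0)) else 0 := by
  let d : Fin 6 →₀ ℕ := Finsupp.single 5 x5 + Finsupp.single 4 x4 + Finsupp.single 3 x3 +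
    Finsupp.single 2 x2 + Finsupp.single 1 x1 + Finsupp.single 0 x0
  have h : (((((1 * X 5 ^ x5) * X 4 ^ x4) * X 3 ^ x3) * X 2 ^ x2) * X 1 ^ x1) * X 0 ^ x0 * 1 =
      (monomial d 1 : MvPolynomial (Fin 6) (ZMod 2)) := by
    simp only [X_pow_eq_monomial, one_mul, mul_one, monomial_mul, d]
  have h5 : d 5 = x5 := by simp [d]
  have h4 : d 4 = x4 := by simp [d]
  have h3 : d 3 = x3 := by simp [d]
  have h2 : d 2 = x2 := by simp [d]
  have h1 : d 1 = x1 := by simp [d]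
  have h0 : d 0 = x0 := by simp [d]
  have hd := degree_six d
  have hi : idx d = num x5 x4 x3 x2 x1 x0 := by simp only [idx, h5, h4, h3, h2, h1, h0]
  rw [h5, h4, h3, h2, h1, h0] at hd
  rw [h, ← hd, LL, LinearMap.comp_apply,
    homogeneousComponent_of_mem (isHomogeneous_monomial (1 : ZMod 2) (rfl : d.degree = d.degree))]
  by_cases hc : 13 = d.degree
  · rw [if_pos hc, if_pos hc.symm, Psi_monomial, hi]
  · rw [if_neg hc, if_neg (Ne.symm hc), map_zero]

theorem gen_nil (r acc : ℕ) : bits (gen .nil r acc) = if r = 0 then bits (code acc) else 0 := by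
  cases r with
  | zero => rfl
  | succ r => exact bits_zero

theorem gen_cons (p : List ℕ) (b : ℕ) (t : Factors) (r acc : ℕ) :
    bits (gen (.cons p b t) r acc) =
      (p.map fun e => if e ≤ r then bits (gen t (r - e) (acc + tab b (r - e))) else 0).sum := by
  induction p with
  | nil => exact bits_zero
  | cons e p ih =>
    rw [List.map_cons, List.sum_cons, ← ih]
    have h : gen (.cons (e :: p) b t) r acc = ite' (Nat.ble e r)
        (Nat.xor (gen (.cons p b t) r acc) (force (Nat.sub r e) fun r' =>
          force (Nat.add acc (tab b r')) fun acc' => gen t r' acc')) (gen (.cons p b t) r acc) := rfl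
    rw [h]
    simp only [force_eq]
    by_cases hc : e ≤ r
    · rw [if_pos hc, Nat.ble_eq_true_of_le hc, add_comm]
      exact bits_xor _ _
    · have : Nat.ble e r = false := by
        cases hb : Nat.ble e r
        · rfl
        · exact absurd (Nat.le_of_ble_eq_true hb) hc
      rw [if_neg hc, this, zero_add]
      rfl

theorem ite_sum (c : Prop) [Decidable c] (l : List ℕ) (f : ℕ → ℕ → ZMod 2) :
    (if c then (l.map f).sum else 0) = (l.map fun x => if c then f x else 0).sum := by
  by_cases hc : c
  · simp only [if_pos hc]
  · simp only [if_neg hc]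
    rw [List.map_const', List.sum_replicate, smul_zero]

/-- The factors of the total square of a monomial. -/
def facs (e0 e1 e2 e3 e4 e5 : ℕ) : Factors :=
  .cons (powL e5) (binT 0) <| .cons (powL e4) (binT 1) <| .cons (powL e3) (binT 2) <|
    .cons (powL e2) (binT 3) <| .cons (powL e1) (binT 4) <| .cons (powL e0) (binT 5) .nil

theorem bits_gen (e0 e1 e2 e3 e4 e5 : ℕ) :
    bits (gen (facs e0 e1 e2 e3 e4 e5) 13 0) =
      ((powL e5).map fun x5 => ((powL e4).map fun x4 => ((powL e3).map fun x3 =>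
        ((powL e2).map fun x2 => ((powL e1).map fun x1 => ((powL e0).map fun x0 =>
          if x5 + x4 + x3 + x2 + x1 + x0 = 13 then bits (code (num x5 x4 x3 x2 x1 x0)) else 0
          ).sum).sum).sum).sum).sum).sum := by
  unfold facs
  simp only [gen_cons, gen_nil, ite_sum]
  refine congrArg List.sum (List.map_congr_left fun x5 _ => ?_)
  refine congrArg List.sum (List.map_congr_left fun x4 _ => ?_)
  refine congrArg List.sum (List.map_congr_left fun x3 _ => ?_)
  refine congrArg List.sum (List.map_congr_left fun x2 _ => ?_)
  refine congrArg List.sum (List.map_congr_left fun x1 _ => ?_)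
  refine congrArg List.sum (List.map_congr_left fun x0 _ => ?_)
  by_cases h : x5 + x4 + x3 + x2 + x1 + x0 = 13
  · rw [if_pos h, if_pos (by omega), if_pos (by omega), if_pos (by omega), if_pos (by omega),
      if_pos (by omega), if_pos (by omega), if_pos (by omega)]
    rfl
  · rw [if_neg h]
    split_ifs <;> first | rfl | omega

theorem LL_sqT (d : Fin 6 →₀ ℕ) (hd : d.degree ≤ 12) :
    LL (sqT 6 (monomial d 1)) = bits (gen (facs (d 0) (d 1) (d 2) (d 3) (d 4) (d 5)) 13 0) := by
  have hd' := degree_six d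
  have h : sqT 6 (monomial d 1) = 1 * (((powL (d 5)).map fun x => X 5 ^ x).sum *
      (1 * (((powL (d 4)).map fun x => X 4 ^ x).sum *
      (1 * (((powL (d 3)).map fun x => X 3 ^ x).sum *
      (1 * (((powL (d 2)).map fun x => X 2 ^ x).sum *
      (1 * (((powL (d 1)).map fun x => X 1 ^ x).sum *
      (1 * (((powL (d 0)).map fun x => X 0 ^ x).sum * 1))))))))))) := by
    rw [sqT, aeval_monomial, map_one, Finsupp.prod_fintype _ _ (fun i => pow_zero _),
      Fin.prod_univ_six, pow_tbl _ _ (by omega), pow_tbl _ _ (by omega), pow_tbl _ _ (by omega),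
      pow_tbl _ _ (by omega), pow_tbl _ _ (by omega), pow_tbl _ _ (by omega)]
    ring
  rw [h, bits_gen]
  simp only [one_mul]
  rw [← one_mul (List.sum _ * _)]
  simp only [LL_mul_sum, LL_monomial]

/-! ### The hit subspace -/

theorem LL_sqT_mem (d : Fin 6 →₀ ℕ) (hd : d.degree ≤ 12) :
    LL (sqT 6 (monomial d 1)) ∈ spanGen 6 12 .nil := by
  rw [LL_sqT d hd]
  rw [degree_six] at hd
  have hmem : bits (gen (facs (d 0) (d 1) (d 2) (d 3) (d 4) (d 5)) 13 0) ∈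
      spanGen 0 (12 - d 0 - d 1 - d 2 - d 3 - d 4 - d 5)
        (facs (d 0) (d 1) (d 2) (d 3) (d 4) (d 5)) := Submodule.mem_span_singleton_self _
  have step (n r : ℕ) (ps : Factors) (e : ℕ) (he : e < r + 1) :
      spanGen n (r - e) (.cons (powL e) (binT n) ps) ≤ spanGen (n + 1) r ps :=
    le_iSup₂_of_le (f := fun e (_ : e < r + 1) =>
      spanGen n (r - e) (.cons (powL e) (binT n) ps)) e he le_rfl
  refine step 5 12 _ (d 0) (by omega) ?_
  refine step 4 _ _ (d 1) (by omega) ?_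
  refine step 3 _ _ (d 2) (by omega) ?_
  refine step 2 _ _ (d 3) (by omega) ?_
  refine step 1 _ _ (d 4) (by omega) ?_
  exact step 0 _ _ (d 5) (by omega) hmem

theorem map_hit_le : (hitSub 6 13).map Psi ≤ spanGen 6 12 .nil := by
  rw [hitSub, Submodule.map_span, Submodule.span_le]
  rintro _ ⟨_, ⟨k, f, hk1, hk2, hf, rfl⟩, rfl⟩
  change LL (sqT 6 f) ∈ spanGen 6 12 .nil
  rw [f.as_sum, map_sum, map_sum]
  refine Submodule.sum_mem _ fun d hd => ?_
  rw [monomial_smul_one, map_smul, map_smul]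
  refine Submodule.smul_mem _ _ (LL_sqT_mem d ?_)
  have hw : d.degree = 13 - k := by
    rw [Finsupp.degree_eq_weight_one]
    exact hf (mem_support_iff.1 hd)
  omega

theorem bits_mem (e0 e1 e2 e3 e4 e5 : ℕ) (h : e0 + e1 + e2 + e3 + e4 + e5 ≤ 12) :
    bits (gen (facs e0 e1 e2 e3 e4 e5) 13 0) ∈ (hitSub 6 13).map Psi := by
  let d : Fin 6 →₀ ℕ := Finsupp.equivFunOnFinite.symm ![e0, e1, e2, e3, e4, e5]
  have hd : d.degree = e5 + e4 + e3 + e2 + e1 + e0 := degree_six d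
  have hL : LL (sqT 6 (monomial d 1)) = bits (gen (facs e0 e1 e2 e3 e4 e5) 13 0) :=
    LL_sqT d (by omega)
  rw [← hL]
  refine Submodule.mem_map_of_mem (Submodule.subset_span
    ⟨13 - d.degree, monomial d 1, by omega, by omega, ?_, rfl⟩)
  exact isHomogeneous_monomial _ (by omega)

theorem le_map_hit : spanGen 6 12 .nil ≤ (hitSub 6 13).map Psi := by
  have step (n r : ℕ) (ps : Factors) (S : Submodule (ZMod 2) (ℕ → ZMod 2))
      (h : ∀ e, e < r + 1 → spanGen n (r - e) (.cons (powL e) (binT n) ps) ≤ S) :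
      spanGen (n + 1) r ps ≤ S := iSup₂_le h
  refine step 5 12 _ _ fun e0 h0 => step 4 _ _ _ fun e1 h1 => step 3 _ _ _ fun e2 h2 =>
    step 2 _ _ _ fun e3 h3 => step 1 _ _ _ fun e4 h4 => step 0 _ _ _ fun e5 h5 => ?_
  have hmem := bits_mem e0 e1 e2 e3 e4 e5 (by omega)
  exact (Submodule.span_singleton_le_iff_mem _ _).2 hmem

theorem map_hit : (hitSub 6 13).map Psi = spanGen 6 12 .nil :=
  le_antisymm map_hit_le le_map_hit

theorem hit_le : hitSub 6 13 ≤ homogeneousSubmodule (Fin 6) (ZMod 2) 13 := by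
  rw [hitSub, Submodule.span_le]
  rintro _ ⟨k, f, _, _, _, rfl⟩
  exact homogeneousComponent_isHomogeneous 13 _

/-! ### The homogeneous polynomials of degree 13 -/

theorem finrank_homog (n : ℕ) :
    Module.finrank (ZMod 2) (homogeneousSubmodule (Fin 6) (ZMod 2) n) = (6 + n - 1).choose n := by
  let s : Finset (Fin 6 →₀ ℕ) := Finset.finsuppAntidiag Finset.univ n
  have hs : ((s : Set (Fin 6 →₀ ℕ))) = {d | d.degree = n} := by
    ext d
    simp [s, Finset.mem_finsuppAntidiag, Finsupp.degree_eq_sum]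
  have hsp : homogeneousSubmodule (Fin 6) (ZMod 2) n =
      Submodule.span (ZMod 2) (Set.range fun d : s => monomial (d : Fin 6 →₀ ℕ) (1 : ZMod 2)) := by
    apply le_antisymm
    · intro p hp
      rw [p.as_sum]
      refine Submodule.sum_mem _ fun d hd => ?_
      rw [monomial_smul_one]
      refine Submodule.smul_mem _ _ (Submodule.subset_span ⟨⟨d, ?_⟩, rfl⟩)
      rw [← Finset.mem_coe, hs, Set.mem_ofPred_eq, Finsupp.degree_eq_weight_one]
      exact hp (mem_support_iff.1 hd)
    · rw [Submodule.span_le]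
      rintro _ ⟨⟨d, hd⟩, rfl⟩
      rw [← Finset.mem_coe, hs] at hd
      exact isHomogeneous_monomial _ hd
  have hli : LinearIndependent (ZMod 2)
      (fun d : s => monomial (d : Fin 6 →₀ ℕ) (1 : ZMod 2)) := by
    have := (basisMonomials (Fin 6) (ZMod 2)).linearIndependent.comp
      (fun d : s => (d : Fin 6 →₀ ℕ)) Subtype.val_injective
    rwa [coe_basisMonomials] at this
  rw [hsp, finrank_span_eq_card hli, Fintype.card_coe,
    Finset.card_finsuppAntidiag_nat_eq_choose, Finset.card_univ, Fintype.card_fin]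

theorem finrank_homog_thirteen :
    Module.finrank (ZMod 2) (homogeneousSubmodule (Fin 6) (ZMod 2) 13) = 8568 := by
  rw [finrank_homog]
  decide +kernel

theorem big : test (iter 6 12 .nil .nil) 7274 = true := by decide +kernel

theorem finrank_hit : Module.finrank (ZMod 2)
    ((hitSub 6 13).comap (homogeneousSubmodule (Fin 6) (ZMod 2) 13).subtype) = 7274 := by
  set V := homogeneousSubmodule (Fin 6) (ZMod 2) 13 with hV
  have hinj : Function.Injective (Psi ∘ₗ V.subtype) := by
    rw [← LinearMap.ker_eq_bot, LinearMap.ker_eq_bot']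
    rintro ⟨p, hp⟩ h
    exact Subtype.ext (Psi_inj p hp h)
  have hm : ((hitSub 6 13).comap V.subtype).map (Psi ∘ₗ V.subtype) =
      Sp (iter 6 12 .nil .nil) := by
    rw [Submodule.map_comp, Submodule.map_comap_subtype, inf_eq_right.2 hit_le, map_hit,
      iter_spec, Sp_nil, bot_sup_eq]
  rw [LinearEquiv.finrank_eq (Submodule.equivMapOfInjective _ hinj _), hm]
  exact test_spec _ _ big

theorem main : Module.finrank (ZMod 2) (QP 6 13) = 1294 := by
  have : Module.Finite (ZMod 2) (homogeneousSubmodule (Fin 6) (ZMod 2) 13) :=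
    Module.finite_of_finrank_pos (by rw [finrank_homog_thirteen]; norm_num)
  have h := Submodule.finrank_quotient_add_finrank
    ((hitSub 6 13).comap (homogeneousSubmodule (Fin 6) (ZMod 2) 13).subtype)
  rw [finrank_hit, finrank_homog_thirteen] at h
  have aux : ∀ x, x + 7274 = 8568 → x = 1294 := fun x hx => by omega
  exact aux _ h

end Hit613

/-- The cohit space `QP_13^{⊗6}` has dimension 1294 over `F2`
(correcting the previously published value 1303). -/
theorem dim_QP_6_13 : Module.finrank (ZMod 2) (QP 6 13) = 1294 := by
  exact Hit613.main
end
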